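/- arXiv:2312.10330 — 5 statements merged into one kernel-verified Lean document; each statement's English description precedes it below -/
import Mathlib

section
/- Suppose (θ_n)_{n≥1}, (g_n^i), (Δ_n) form a block majorization-minimization scheme for f started at θ_0. Then for every n ≥ 1: f(θ_{n−1}) − f(θ_n) ≥ Σ_{i=1}^m ( g_n^i(θ_n^i) − f_n^i(θ_n^i) ) − m·Δ_n ≥ −m·Δ_n; consequently, if f is bounded below on Θ by f* ∈ ℝ, then for every N ≥ 1: Σ_{n=1}^N Σ_{i=1}^m ( g_n^i(θ_n^i) − f_n^i(θ_n^i) ) ≤ f(θ_0) − f* + m·Σ_{n=1}^N Δ_n. -/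
/-- The point of the product space whose first `i-1` blocks are those of `θ n`, whose
`i`-th block is `v`, and whose remaining blocks are those of `θ (n-1)`.  Thus the `i`-th
marginal objective at cycle `n` is `fun v => f (mixPt θ n i v)`. -/
def mixPt {m : ℕ} {X : Fin m → Type*} (θ : ℕ → ∀ i, X i) (n : ℕ) (i : Fin m)
    (v : X i) : ∀ j, X j :=
  Function.update (fun j => if (j : ℕ) < (i : ℕ) then θ n j else θ (n - 1) j) i v

/-- monotonicity of the objective for block MM.  For a block
majorization-minimization scheme `(θ_n, g_n^i, Δ_n)` for `f` started at `θ 0`: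
`f(θ_{n-1}) - f(θ_n) ≥ ∑_i (g_n^i(θ_n^i) - f_n^i(θ_n^i)) - m Δ_n ≥ - m Δ_n`, and if `f` is
bounded below by `f*`, then for every `N ≥ 1`,
`∑_{n=1}^N ∑_i (g_n^i(θ_n^i) - f_n^i(θ_n^i)) ≤ f(θ_0) - f* + m ∑_{n=1}^N Δ_n`. -/
theorem bmm_monotonicity {m : ℕ} (hm : 1 ≤ m) {X : Fin m → Type*}
    (f : (∀ i, X i) → ℝ) (θ : ℕ → ∀ i, X i)
    (g : ℕ → ∀ i : Fin m, X i → ℝ) (Δ : ℕ → ℝ)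
    (hΔ : ∀ n, 1 ≤ n → 0 ≤ Δ n)
    (hmaj : ∀ n, 1 ≤ n → ∀ i, ∀ v : X i, f (mixPt θ n i v) ≤ g n i v)
    (hsharp : ∀ n, 1 ≤ n → ∀ i, g n i (θ (n - 1) i) = f (mixPt θ n i (θ (n - 1) i)))
    (hopt : ∀ n, 1 ≤ n → ∀ i, ∀ v : X i, g n i (θ n i) ≤ g n i v + Δ n) :
    (∀ n, 1 ≤ n →
      (∑ i, (g n i (θ n i) - f (mixPt θ n i (θ n i)))) - (m : ℝ) * Δ n
          ≤ f (θ (n - 1)) - f (θ n)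
        ∧ -((m : ℝ) * Δ n)
          ≤ (∑ i, (g n i (θ n i) - f (mixPt θ n i (θ n i)))) - (m : ℝ) * Δ n)
    ∧ (∀ fstar : ℝ, (∀ x, fstar ≤ f x) →
        ∀ N, 1 ≤ N →
          ∑ n ∈ Finset.Icc 1 N, ∑ i, (g n i (θ n i) - f (mixPt θ n i (θ n i)))
            ≤ f (θ 0) - fstar + (m : ℝ) * ∑ n ∈ Finset.Icc 1 N, Δ n) := by
  have key : ∀ n, 1 ≤ n →
      (∑ i, (g n i (θ n i) - f (mixPt θ n i (θ n i)))) - (m : ℝ) * Δ n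
          ≤ f (θ (n - 1)) - f (θ n) := by
    intro n hn
    let P : ℕ → ∀ j, X j := fun k j => if (j : ℕ) < k then θ n j else θ (n - 1) j
    have h1 : ∀ i : Fin m, mixPt θ n i (θ n i) = P ((i : ℕ) + 1) := by
      intro i
      funext j
      by_cases h : j = i
      · subst h
        simp [mixPt, P]
      · have h' : (j : ℕ) ≠ i := fun e => h (Fin.ext e)
        have h2 : ((j : ℕ) < (i : ℕ) + 1) ↔ ((j : ℕ) < i) := by omega
        simp only [mixPt, P, Function.update_of_ne h, h2]
    have h0 : ∀ i : Fin m, mixPt θ n i (θ (n - 1) i) = P (i : ℕ) := by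
      intro i
      funext j
      by_cases h : j = i
      · subst h
        simp [mixPt, P]
      · simp only [mixPt, P, Function.update_of_ne h]
    have hP0 : P 0 = θ (n - 1) := by
      funext j
      simp [P]
    have hPm : P m = θ n := by
      funext j
      simp [P]
    have hsum : ∑ i : Fin m, (f (P (i : ℕ)) - f (P ((i : ℕ) + 1))) = f (P 0) - f (P m) := by
      rw [Fin.sum_univ_eq_sum_range (fun k => f (P k) - f (P (k + 1))) m]
      exact Finset.sum_range_sub' (fun k => f (P k)) m
    have hle : ∑ i : Fin m, (g n i (θ n i) - f (mixPt θ n i (θ n i)))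
        ≤ ∑ i : Fin m, ((f (P (i : ℕ)) - f (P ((i : ℕ) + 1))) + Δ n) := by
      apply Finset.sum_le_sum
      intro i _
      have a := hopt n hn i (θ (n - 1) i)
      rw [hsharp n hn i, h0 i] at a
      rw [h1 i]
      linarith
    rw [Finset.sum_add_distrib, hsum, hP0, hPm] at hle
    simp at hle
    simp
    linarith
  refine ⟨fun n hn => ⟨key n hn, ?_⟩, ?_⟩
  · have : 0 ≤ ∑ i, (g n i (θ n i) - f (mixPt θ n i (θ n i))) :=
      Finset.sum_nonneg fun i _ => sub_nonneg.2 (hmaj n hn i _)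
    linarith
  · intro fstar hf N _
    have tel : ∀ N : ℕ, ∑ n ∈ Finset.Icc 1 N, ∑ i, (g n i (θ n i) - f (mixPt θ n i (θ n i)))
            ≤ f (θ 0) - f (θ N) + (m : ℝ) * ∑ n ∈ Finset.Icc 1 N, Δ n := by
      intro N
      induction N with
      | zero => simp
      | succ k ih =>
        rw [Finset.sum_Icc_succ_top (by omega), Finset.sum_Icc_succ_top (by omega), mul_add]
        have a := key (k + 1) (by omega)
        rw [Nat.add_sub_cancel] at a
        linarith
    have := tel N
    have := hf (θ N)
    linarith
end

section
/- Suppose (θ_n)_{n≥1}, (g_n^i), (Δ_n) form a block majorization-minimization scheme for f started at θ_0, where each Θ_i is a metric space, Σ_{n=1}^∞ Δ_n < ∞, and the sublevel set {θ ∈ Θ : f(θ) ≤ a} is compact for every a ∈ ℝ. Then the set {θ_n : n ≥ 0} is contained in the compact set {θ ∈ Θ : f(θ) ≤ f(θ_0) + m·Σ_{k=1}^∞ Δ_k}; in particular {θ_n : n ≥ 0} is bounded. -/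
/-- boundedness of the iterates.  For a block majorization-minimization
scheme with summable optimality gaps and compact sublevel sets of `f`, the iterates all lie
in the compact sublevel set `{θ : f(θ) ≤ f(θ_0) + m ∑_{k=1}^∞ Δ_k}`; in particular the set
of iterates is bounded. -/
theorem bmm_iterates_bounded {m : ℕ} (hm : 1 ≤ m) {X : Fin m → Type*}
    [∀ i, MetricSpace (X i)]
    (f : (∀ i, X i) → ℝ) (θ : ℕ → ∀ i, X i)
    (g : ℕ → ∀ i : Fin m, X i → ℝ) (Δ : ℕ → ℝ)
    (hΔ : ∀ n, 1 ≤ n → 0 ≤ Δ n)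
    (hmaj : ∀ n, 1 ≤ n → ∀ i, ∀ v : X i, f (mixPt θ n i v) ≤ g n i v)
    (hsharp : ∀ n, 1 ≤ n → ∀ i, g n i (θ (n - 1) i) = f (mixPt θ n i (θ (n - 1) i)))
    (hopt : ∀ n, 1 ≤ n → ∀ i, ∀ v : X i, g n i (θ n i) ≤ g n i v + Δ n)
    (hΔsum : Summable fun n => Δ (n + 1))
    (hcompact : ∀ a : ℝ, IsCompact {x : ∀ i, X i | f x ≤ a}) :
    (∀ n : ℕ, θ n ∈ {x : ∀ i, X i | f x ≤ f (θ 0) + (m : ℝ) * ∑' k, Δ (k + 1)})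
    ∧ IsCompact {x : ∀ i, X i | f x ≤ f (θ 0) + (m : ℝ) * ∑' k, Δ (k + 1)}
    ∧ Bornology.IsBounded (Set.range θ) := by
  have hcyc : ∀ n : ℕ, ∀ k : ℕ, k ≤ m →
      f (fun j => if (j : ℕ) < k then θ (n + 1) j else θ n j) ≤ f (θ n) + (k : ℝ) * Δ (n + 1) := by
    intro n k
    induction k with
    | zero => intro _; simp
    | succ k ih =>
      intro hk
      have h1 := ih (by omega)
      let i : Fin m := ⟨k, by omega⟩
      have e1 : mixPt θ (n + 1) i (θ (n + 1) i)
          = fun j : Fin m => if (j : ℕ) < k + 1 then θ (n + 1) j else θ n j := by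
        funext j
        unfold mixPt
        by_cases hj : j = i
        · subst hj; simp [i]
        · have hj' : (j : ℕ) ≠ k := fun h => hj (Fin.ext h)
          rw [Function.update_of_ne hj]
          have : ((j : ℕ) < k + 1) ↔ ((j : ℕ) < (i : ℕ)) := by simp only [i]; omega
          simp [this]
      have e2 : mixPt θ (n + 1) i (θ n i)
          = fun j : Fin m => if (j : ℕ) < k then θ (n + 1) j else θ n j := by
        funext j
        unfold mixPt
        by_cases hj : j = i
        · subst hj; simp [i]
        · rw [Function.update_of_ne hj]
          simp [i]
      have a := hmaj (n + 1) (by omega) i (θ (n + 1) i)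
      have b := hopt (n + 1) (by omega) i (θ n i)
      have c := hsharp (n + 1) (by omega) i
      rw [Nat.add_sub_cancel, e2] at c
      rw [e1] at a
      push_cast
      linarith
  have hstep : ∀ n, f (θ (n + 1)) ≤ f (θ n) + (m : ℝ) * Δ (n + 1) := by
    intro n
    have h := hcyc n m le_rfl
    simpa using h
  have hsum : ∀ n, f (θ n) ≤ f (θ 0) + (m : ℝ) * ∑ k ∈ Finset.range n, Δ (k + 1) := by
    intro n
    induction n with
    | zero => simp
    | succ n ih =>
      rw [Finset.sum_range_succ, mul_add]
      linarith [hstep n]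
  have hall : ∀ n : ℕ, θ n ∈ {x : ∀ i, X i | f x ≤ f (θ 0) + (m : ℝ) * ∑' k, Δ (k + 1)} := by
    intro n
    have h := hΔsum.sum_le_tsum (Finset.range n) (fun k _ => hΔ (k + 1) (by omega))
    have h2 := mul_le_mul_of_nonneg_left h (Nat.cast_nonneg (α := ℝ) m)
    exact (hsum n).trans (by linarith)
  refine ⟨hall, hcompact _, (hcompact (f (θ 0) + (m : ℝ) * ∑' k, Δ (k + 1))).isBounded.subset ?_⟩
  rintro _ ⟨n, rfl⟩
  exact hall n
end

section
/- Let m ≤ 2. Suppose (θ_n)_{n≥1} is a BMM sequence with surrogates (g_n^i) and optimality gaps (Δ_n) for f started at θ_0, where each surrogate g_n^i is differentiable with L_g-Lipschitz gradient for a common constant L_g ≥ 0. Assume Σ_{n≥1} Δ_n < ∞, the sublevel set {θ ∈ Θ : f(θ) ≤ a} is compact for every a ∈ ℝ, each g_n^i attains its minimum over Θ_i at some θ_n^{i⋆} ∈ Θ_i, and ‖θ_n^{i⋆} − θ_n^i‖ → 0 as n → ∞. Then every limit point of (θ_n)_{n≥0} is a stationary point of f over Θ. -/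
open Filter RealInnerProductSpace

/-- The `i`-th block partial gradient `∇_i f(x)`: the gradient at `x i` of the map
`u ↦ f (x with i-th block replaced by u)`. -/
noncomputable def gradi {m : ℕ} {E : Fin m → Type*} [∀ i, NormedAddCommGroup (E i)]
    [∀ i, InnerProductSpace ℝ (E i)] [∀ i, CompleteSpace (E i)]
    (f : (∀ i, E i) → ℝ) (x : ∀ i, E i) (i : Fin m) : E i :=
  gradient (fun u => f (Function.update x i u)) (x i)

lemma bmm_taylor {F : Type*} [NormedAddCommGroup F] [InnerProductSpace ℝ F] [CompleteSpace F]
    (φ : F → ℝ) (hφ : Differentiable ℝ φ) (K : ℝ) (hK : 0 ≤ K)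
    (hL : ∀ u v, ‖gradient φ u - gradient φ v‖ ≤ K * ‖u - v‖) (x d : F) :
    φ (x + d) ≤ φ x + ⟪gradient φ x, d⟫ + K * ‖d‖ ^ 2 := by
  have h := (convex_segment (𝕜 := ℝ) x (x + d)).norm_image_sub_le_of_norm_fderiv_le'
    (f := φ) (C := K * ‖d‖) (φ := fderiv ℝ φ x) (x := x) (y := x + d)
    (fun y _ => hφ y) ?_ (left_mem_segment ℝ _ _) (right_mem_segment ℝ _ _)
  · have e : (fderiv ℝ φ x) d = ⟪gradient φ x, d⟫ := by
      simp [gradient]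
    rw [add_sub_cancel_left, e, Real.norm_eq_abs] at h
    have := le_of_abs_le h
    nlinarith
  · intro y hy
    have h1 : ‖fderiv ℝ φ y - fderiv ℝ φ x‖ = ‖gradient φ y - gradient φ x‖ := by
      unfold gradient
      rw [← map_sub, LinearIsometryEquiv.norm_map]
    rw [h1]
    refine (hL y x).trans (mul_le_mul_of_nonneg_left ?_ hK)
    have := norm_sub_le_of_mem_segment hy
    simpa using this

lemma bmm_key {F : Type*} [NormedAddCommGroup F] [InnerProductSpace ℝ F] [CompleteSpace F]
    (g φ : F → ℝ) (hg : Differentiable ℝ g) (hφ : Differentiable ℝ φ) (K L : ℝ) (hK : 0 ≤ K)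
    (hL : 0 ≤ L)
    (hgL : ∀ u v, ‖gradient g u - gradient g v‖ ≤ K * ‖u - v‖)
    (hφL : ∀ u v, ‖gradient φ u - gradient φ v‖ ≤ L * ‖u - v‖)
    (hmaj : ∀ v, φ v ≤ g v) (S : Set F) (hS : Convex ℝ S) (x u : F) (hx : x ∈ S) (hu : u ∈ S)
    (ε : ℝ) (h1 : g x - φ x ≤ ε) (h2 : ∀ v ∈ S, g x ≤ g v + ε) (s : ℝ) (hs : 0 < s)
    (hs1 : s ≤ 1) :
    0 ≤ ⟪gradient φ x, u - x⟫ + 2 * ε / s + (2 * K + L) * s * ‖u - x‖ ^ 2 := by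
  have hgr : ∀ y, gradient (fun v => g v - φ v) y = gradient g y - gradient φ y := by
    intro y
    unfold gradient
    rw [← map_sub, fderiv_fun_sub (hg y) (hφ y)]
  have a := bmm_taylor g hg K hK hgL x (s • (u - x))
  have b := bmm_taylor (fun v => g v - φ v) (hg.sub hφ) (K + L) (by positivity) (by
    intro y z
    rw [hgr, hgr]
    calc _ = ‖(gradient g y - gradient g z) - (gradient φ y - gradient φ z)‖ := by
          congr 1; abel
      _ ≤ _ := norm_sub_le _ _
      _ ≤ _ := by linarith [hgL y z, hφL y z]) x (-(s • (u - x)))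
  have c := h2 (x + s • (u - x)) (hS.add_smul_sub_mem hx hu ⟨hs.le, hs1⟩)
  have d := hmaj (x + -(s • (u - x)))
  rw [hgr] at b
  simp only [norm_neg, inner_neg_right, inner_sub_left, norm_smul, inner_smul_right,
    Real.norm_eq_abs, abs_of_pos hs] at a b
  have e : 0 ≤ s * (⟪gradient φ x, u - x⟫ + 2 * ε / s + (2 * K + L) * s * ‖u - x‖ ^ 2) := by
    have : s * (2 * ε / s) = 2 * ε := by field_simp
    rw [mul_add, mul_add, this]
    nlinarith
  exact nonneg_of_mul_nonneg_right e hs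

/-- asymptotic convergence to stationary points, `m ≤ 2` blocks, smooth
surrogates.  For a BMM sequence with `L_g`-smooth surrogates, summable optimality gaps,
compact sublevel sets, exact minimizers `θ_n^{i⋆}` with `‖θ_n^{i⋆} - θ_n^i‖ → 0`, every
limit point of `(θ_n)` is a stationary point of `f` over `Θ`. -/
theorem bmm_two_blocks_limit_points_stationary {m : ℕ} (hm : 1 ≤ m) (hm2 : m ≤ 2)
    {E : Fin m → Type*} [∀ i, NormedAddCommGroup (E i)]
    [∀ i, InnerProductSpace ℝ (E i)] [∀ i, FiniteDimensional ℝ (E i)]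
    (Θ : ∀ i, Set (E i)) (hne : ∀ i, (Θ i).Nonempty)
    (hclosed : ∀ i, IsClosed (Θ i)) (hconv : ∀ i, Convex ℝ (Θ i))
    (f : (∀ i, E i) → ℝ) (Lf : ℝ) (hLf : 0 < Lf)
    (hdiff : Differentiable ℝ f)
    (hsmooth : ∀ x y : ∀ i, E i,
      Real.sqrt (∑ i, ‖gradi f x i - gradi f y i‖ ^ 2)
        ≤ Lf * Real.sqrt (∑ i, ‖x i - y i‖ ^ 2))
    (fstar : ℝ) (hbdd : ∀ x, fstar ≤ f x)
    (θ : ℕ → ∀ i, E i) (hθ : ∀ n i, θ n i ∈ Θ i)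
    (g : ℕ → ∀ i : Fin m, E i → ℝ) (Δ : ℕ → ℝ) (hΔ : ∀ n, 1 ≤ n → 0 ≤ Δ n)
    (hmaj : ∀ n, 1 ≤ n → ∀ i, ∀ v : E i, f (mixPt θ n i v) ≤ g n i v)
    (hsharp : ∀ n, 1 ≤ n → ∀ i, g n i (θ (n - 1) i) = f (mixPt θ n i (θ (n - 1) i)))
    (hopt : ∀ n, 1 ≤ n → ∀ i, ∀ v ∈ Θ i, g n i (θ n i) ≤ g n i v + Δ n)
    (Lg : ℝ) (hLg : 0 ≤ Lg)
    (hgdiff : ∀ n, 1 ≤ n → ∀ i, Differentiable ℝ (g n i))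
    (hgLip : ∀ n, 1 ≤ n → ∀ i, ∀ u v : E i,
      ‖gradient (g n i) u - gradient (g n i) v‖ ≤ Lg * ‖u - v‖)
    (hΔsum : Summable fun n => Δ (n + 1))
    (hcompact : ∀ a : ℝ, IsCompact {x : ∀ i, E i | (∀ i, x i ∈ Θ i) ∧ f x ≤ a})
    (θstar : ℕ → ∀ i, E i)
    (hstarmem : ∀ n, 1 ≤ n → ∀ i, θstar n i ∈ Θ i)
    (hstarmin : ∀ n, 1 ≤ n → ∀ i, ∀ v ∈ Θ i, g n i (θstar n i) ≤ g n i v)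
    (hstarclose : ∀ i, Tendsto (fun n => ‖θstar n i - θ n i‖) atTop (nhds 0)) :
    ∀ θbar : ∀ i, E i, MapClusterPt θbar atTop θ →
      (∀ i, θbar i ∈ Θ i) ∧ ∀ i, ∀ u ∈ Θ i, 0 ≤ ⟪gradi f θbar i, u - θbar i⟫ := by

  classical
  have hgradLip : ∀ x y : ∀ i, E i, ∀ i,
      ‖gradi f x i - gradi f y i‖ ≤ Lf * Real.sqrt (∑ i, ‖x i - y i‖ ^ 2) := by
    intro x y i
    refine le_trans ?_ (hsmooth x y)
    apply Real.le_sqrt_of_sq_le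
    exact Finset.single_le_sum (f := fun i => ‖gradi f x i - gradi f y i‖ ^ 2)
      (fun j _ => by positivity) (Finset.mem_univ i)
  have hgradcont : ∀ i, Continuous (fun x => gradi f x i) := by
    intro i
    rw [continuous_iff_continuousAt]
    intro y
    rw [ContinuousAt, tendsto_iff_norm_sub_tendsto_zero]
    refine squeeze_zero (fun _ => norm_nonneg _) (fun x => hgradLip x y i) ?_
    have hc : Continuous (fun x : ∀ i, E i => Lf * Real.sqrt (∑ i, ‖x i - y i‖ ^ 2)) := by
      fun_prop
    simpa using hc.tendsto y
  -- marginal objectives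
  have hFgrad : ∀ n i v, gradient (fun v => f (mixPt θ n i v)) v = gradi f (mixPt θ n i v) i := by
    intro n i v
    simp [gradi, mixPt]
  have hFdiff : ∀ n i, Differentiable ℝ (fun v => f (mixPt θ n i v)) := by
    intro n i v
    exact (hdiff _).comp v (hasFDerivAt_update _ v).differentiableAt
  have hFLip : ∀ n i (u v : E i), ‖gradient (fun v => f (mixPt θ n i v)) u
      - gradient (fun v => f (mixPt θ n i v)) v‖ ≤ Lf * ‖u - v‖ := by
    intro n i u v
    rw [hFgrad, hFgrad]
    refine (hgradLip _ _ i).trans (le_of_eq ?_)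
    congr 1
    rw [Finset.sum_eq_single i]
    · simp [mixPt]
    · intro j _ hj
      simp [mixPt, hj]
    · simp
  let p : ℕ → ℕ → ∀ j, E j := fun n k j => if (j : ℕ) < k then θ (n + 1) j else θ n j
  have hp0 : ∀ n, p n 0 = θ n := by intro n; ext j; simp [p]
  have hpm : ∀ n, p n m = θ (n + 1) := by intro n; ext j; simp [p]
  have hpa : ∀ n (i : Fin m), mixPt θ (n + 1) i (θ n i) = p n i := by
    intro n i
    ext j
    by_cases h : j = i
    · subst h; simp [mixPt, p]
    · simp [mixPt, p, h]
  have hpb : ∀ n (i : Fin m), mixPt θ (n + 1) i (θ (n + 1) i) = p n (i + 1) := by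
    intro n i
    ext j
    by_cases h : j = i
    · subst h; simp [mixPt, p]
    · have h' : (j : ℕ) ≠ i := fun e => h (Fin.ext e)
      have : ((j : ℕ) < i) ↔ ((j : ℕ) < i + 1) := by omega
      simp only [mixPt, p, Function.update_of_ne h, this, Nat.add_sub_cancel]
  have hS : ∀ n i, g (n + 1) i (θ n i) = f (p n i) := by
    intro n i
    have := hsharp (n + 1) (by omega) i
    simpa [hpa] using this
  have hM : ∀ n (i : Fin m), f (p n (i + 1)) ≤ g (n + 1) i (θ (n + 1) i) := by
    intro n i
    have := hmaj (n + 1) (by omega) i (θ (n + 1) i)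
    rwa [hpb] at this
  have hO : ∀ n i, ∀ v ∈ Θ i, g (n + 1) i (θ (n + 1) i) ≤ g (n + 1) i v + Δ (n + 1) :=
    fun n i v hv => hopt (n + 1) (by omega) i v hv
  let d : ℕ → Fin m → ℝ := fun n i => f (p n i) - f (p n (i + 1)) + Δ (n + 1)
  have hd0 : ∀ n i, 0 ≤ d n i := by
    intro n i
    have := hO n i _ (hθ n i)
    simp only [d]
    linarith [hS n i, hM n i]
  let S : ℕ → ℝ := fun n => ∑ i, d n i
  have hdS : ∀ n i, d n i ≤ S n := fun n i =>
    Finset.single_le_sum (f := d n) (fun j _ => hd0 n j) (Finset.mem_univ i)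
  have hSeq : ∀ n, S n = f (θ n) - f (θ (n + 1)) + m * Δ (n + 1) := by
    intro n
    simp only [S, d, Finset.sum_add_distrib]
    rw [Fin.sum_univ_eq_sum_range (fun k => f (p n k) - f (p n (k + 1))) m,
      Finset.sum_range_sub', hp0, hpm]
    simp
  have hS0 : ∀ n, 0 ≤ S n := fun n => Finset.sum_nonneg fun i _ => hd0 n i
  have hSsum : Summable S := by
    refine summable_of_sum_range_le (c := f (θ 0) - fstar + m * ∑' n, Δ (n + 1)) hS0 ?_
    intro n
    simp only [hSeq, Finset.sum_add_distrib]
    rw [Finset.sum_range_sub' (fun n => f (θ n)), ← Finset.mul_sum]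
    have h1 := hΔsum.sum_le_tsum (Finset.range n) (fun k _ => hΔ (k + 1) (by omega))
    have h2 : (m : ℝ) * ∑ k ∈ Finset.range n, Δ (k + 1) ≤ m * ∑' n, Δ (n + 1) := by gcongr
    linarith [hbdd (θ n)]
  let ε : ℕ → ℝ := fun n => S n + Δ (n + 1)
  have hε : Tendsto ε atTop (nhds 0) := by
    simpa using hSsum.tendsto_atTop_zero.add hΔsum.tendsto_atTop_zero
  intro θbar hcl
  obtain ⟨ψ, hψ, hlim⟩ := hcl.tendsto_subseq
  have hlimi : ∀ i, Tendsto (fun k => θ (ψ k) i) atTop (nhds (θbar i)) :=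
    fun i => (tendsto_pi_nhds.1 hlim) i
  refine ⟨fun i => (hclosed i).mem_of_tendsto (hlimi i) (Eventually.of_forall fun k => hθ _ i),
    ?_⟩
  intro i u hu
  -- main asymptotic inequality
  obtain ⟨η, hη, hmain⟩ : ∃ η : ℕ → ℝ, Tendsto η atTop (nhds 0) ∧ ∀ n, 1 ≤ n → ∀ s : ℝ, 0 < s →
      s ≤ 1 → 0 ≤ ⟪gradi f (θ n) i, u - θ n i⟫ + 2 * η n / s
        + (2 * Lg + Lf) * s * ‖u - θ n i‖ ^ 2 := by
    by_cases hi : (i : ℕ) = 0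
    · refine ⟨ε, hε, ?_⟩
      intro n _ s hs hs1
      have := bmm_key (g (n + 1) i) (fun v => f (mixPt θ (n + 1) i v)) (hgdiff _ (by omega) i)
        (hFdiff _ i) Lg Lf hLg hLf.le (hgLip _ (by omega) i) (hFLip _ i) (hmaj _ (by omega) i)
        (Θ i) (hconv i) (θ n i) u (hθ n i) hu (ε n)
        (by
          rw [hS, hpa]
          have := hΔ (n + 1) (by omega)
          simp only [ε]
          linarith [hS0 n])
        (by
          intro v hv
          have h1 := hO n i v hv
          have h2 := hdS n i
          simp only [ε, d] at *
          linarith [hS n i, hM n i, hΔ (n + 1) (by omega)]) s hs hs1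
      rwa [hFgrad, hpa, hi, hp0] at this
    · have hi' : (i : ℕ) + 1 = m := by omega
      refine ⟨fun n => ε (n - 1), hε.comp (tendsto_sub_atTop_nat 1), ?_⟩
      intro n hn s hs hs1
      obtain ⟨n, rfl⟩ : ∃ k, n = k + 1 := ⟨n - 1, by omega⟩
      have := bmm_key (g (n + 1) i) (fun v => f (mixPt θ (n + 1) i v)) (hgdiff _ (by omega) i)
        (hFdiff _ i) Lg Lf hLg hLf.le (hgLip _ (by omega) i) (hFLip _ i) (hmaj _ (by omega) i)
        (Θ i) (hconv i) (θ (n + 1) i) u (hθ (n + 1) i) hu (ε n)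
        (by
          rw [hpb]
          have h0 := hΔ (n + 1) (by omega)
          have h1 := hO n i _ (hθ n i)
          have h2 := hdS n i
          simp only [ε, d] at *
          linarith [hS n i])
        (by
          intro v hv
          have h1 := hO n i v hv
          simp only [ε] at *
          linarith [hS0 n]) s hs hs1
      rw [hFgrad, hpb, hi', hpm] at this
      simpa using this
  -- pass to the limit along the subsequence
  have hlim1 : ∀ s : ℝ, 0 < s → s ≤ 1 →
      0 ≤ ⟪gradi f θbar i, u - θbar i⟫ + (2 * Lg + Lf) * s * ‖u - θbar i‖ ^ 2 := by
    intro s hs hs1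
    have t1 : Tendsto (fun k => gradi f (θ (ψ k)) i) atTop (nhds (gradi f θbar i)) :=
      ((hgradcont i).tendsto θbar).comp hlim
    have t2 : Tendsto (fun k => u - θ (ψ k) i) atTop (nhds (u - θbar i)) :=
      (hlimi i).const_sub u
    have t3 : Tendsto (fun k => 2 * η (ψ k) / s) atTop (nhds 0) := by
      simpa using ((hη.comp hψ.tendsto_atTop).const_mul 2).div_const s
    have t4 := ((t1.inner t2 (𝕜 := ℝ)).add t3).add ((t2.norm.pow 2).const_mul ((2 * Lg + Lf) * s))
    rw [add_zero] at t4
    refine ge_of_tendsto t4 ?_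
    filter_upwards [eventually_ge_atTop 1] with k hk
    exact hmain (ψ k) (hk.trans (hψ.id_le k)) s hs hs1
  have t5 : Tendsto (fun k : ℕ => ⟪gradi f θbar i, u - θbar i⟫
      + (2 * Lg + Lf) * (1 / ((k : ℝ) + 1)) * ‖u - θbar i‖ ^ 2) atTop
      (nhds ⟪gradi f θbar i, u - θbar i⟫) := by
    simpa using ((tendsto_one_div_add_atTop_nhds_zero_nat.const_mul (2 * Lg + Lf)).mul_const
      (‖u - θbar i‖ ^ 2)).const_add ⟪gradi f θbar i, u - θbar i⟫
  refine ge_of_tendsto' t5 fun k => hlim1 _ (by positivity) ?_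
  rw [div_le_one (by positivity)]
  linarith [(Nat.cast_nonneg k : (0 : ℝ) ≤ k)]
end

section
/- Suppose (θ_n)_{n≥1} is a BMM sequence with surrogates (g_n^i) and optimality gaps (Δ_n) for f started at θ_0, where each g_n^i is differentiable with L_g-Lipschitz gradient for a common constant L_g ≥ 0, there is c > 0 with g_n^i(θ) − f_n^i(θ) ≥ c·‖θ − θ_{n−1}^i‖² for all n, i and θ ∈ E_i, and Σ_{n≥1} Δ_n < ∞. Then there is a constant C > 0, depending only on m, L_f, L_g and c, such that for every n ≥ 2: min_{1≤k≤n} S(θ_k) ≤ C·( f(θ_0) − f* + 1 + Σ_{j=1}^∞ Δ_j )·(log n)^{1/2}/n^{1/4}. -/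
open Filter RealInnerProductSpace

universe u

/-- The stationarity measure
`S(x) = ∑_i sup { ⟪-∇_i f(x), u⟫ : ‖u‖ ≤ 1, x i + u ∈ Θ i }`. -/
noncomputable def Smeasure {m : ℕ} {E : Fin m → Type*} [∀ i, NormedAddCommGroup (E i)]
    [∀ i, InnerProductSpace ℝ (E i)] [∀ i, CompleteSpace (E i)]
    (f : (∀ i, E i) → ℝ) (Θ : ∀ i, Set (E i)) (x : ∀ i, E i) : ℝ :=
  ∑ i, sSup ((fun u => ⟪-gradi f x i, u⟫) '' {u : E i | ‖u‖ ≤ 1 ∧ x i + u ∈ Θ i})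

theorem aux_stat {F : Type*} [NormedAddCommGroup F] [InnerProductSpace ℝ F] [CompleteSpace F]
    (g : F → ℝ) (hg : Differentiable ℝ g) (L D t : ℝ) (hL : 0 ≤ L) (ht : 0 < t) (ht1 : t ≤ 1)
    (hLip : ∀ u v : F, ‖gradient g u - gradient g v‖ ≤ L * ‖u - v‖)
    (K : Set F) (hK : Convex ℝ K) (x : F) (hx : x ∈ K)
    (hmin : ∀ v ∈ K, g x ≤ g v + D) (u : F) (hu : ‖u‖ ≤ 1) (hxu : x + u ∈ K) :
    ⟪-gradient g x, u⟫ ≤ D / t + L * t := by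
  have hmem : x + t • u ∈ K := hK.add_smul_mem hx hxu ⟨ht.le, ht1⟩
  have h1 := hmin _ hmem
  have htu : ‖t • u‖ ≤ t := by
    rw [norm_smul, Real.norm_of_nonneg ht.le]
    nlinarith
  have h2 := (convex_closedBall x t).norm_image_sub_le_of_norm_fderiv_le' (𝕜 := ℝ) (f := g)
    (C := L * t) (φ := fderiv ℝ g x) (x := x) (y := x + t • u)
    (fun z _ => hg z) (by
      intro z hz
      have hz' : ‖z - x‖ ≤ t := by simpa [dist_eq_norm] using hz
      have h3 := hLip z x
      have h4 : ‖fderiv ℝ g z - fderiv ℝ g x‖ = ‖gradient g z - gradient g x‖ := by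
        simp only [gradient]
        rw [← map_sub, LinearIsometryEquiv.norm_map]
      rw [h4]
      exact h3.trans (by gcongr))
    (by simp [ht.le]) (by simpa [dist_eq_norm] using htu)
  have h5 : fderiv ℝ g x (x + t • u - x) = t * ⟪gradient g x, u⟫ := by
    simp [gradient]
  rw [h5, Real.norm_eq_abs] at h2
  have h6 := (abs_le.mp h2).2
  have h7 : ‖x + t • u - x‖ ≤ t := by simpa using htu
  have h8 : L * t * ‖x + t • u - x‖ ≤ L * t * t := by gcongr
  rw [inner_neg_left]
  have h9 : t * (-⟪gradient g x, u⟫) ≤ D + L * t * t := by linarith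
  have : -⟪gradient g x, u⟫ ≤ (D + L * t * t) / t := by
    rw [le_div_iff₀ ht]; linarith
  refine this.trans (le_of_eq ?_)
  field_simp

theorem aux_tangent {F : Type*} [NormedAddCommGroup F] [InnerProductSpace ℝ F] [CompleteSpace F]
    (g h : F → ℝ) (hg : Differentiable ℝ g) (hh : Differentiable ℝ h)
    (hle : ∀ v, h v ≤ g v) (x : F) (hx : g x = h x) : gradient g x = gradient h x := by
  have h1 : IsLocalMin (fun v => g v - h v) x := by
    refine Filter.Eventually.of_forall (fun v => ?_)
    have := hle v
    simp only [hx, sub_self]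
    linarith
  have h2 := h1.fderiv_eq_zero
  have h3 : fderiv ℝ (fun v => g v - h v) x = fderiv ℝ g x - fderiv ℝ h x :=
    fderiv_fun_sub (hg x) (hh x)
  rw [h3, sub_eq_zero] at h2
  simp [gradient, h2]

def pre {m : ℕ} {X : Fin m → Type*} (θ : ℕ → ∀ i, X i) (n k : ℕ) : ∀ j, X j :=
  fun j => if (j : ℕ) < k then θ n j else θ (n - 1) j

theorem mix_old {m : ℕ} {X : Fin m → Type*} (θ : ℕ → ∀ i, X i) (n : ℕ) (i : Fin m) :
    mixPt θ n i (θ (n - 1) i) = pre θ n i := by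
  funext j
  by_cases h : j = i
  · subst h; simp [mixPt, pre]
  · simp [mixPt, pre, h]

theorem mix_new {m : ℕ} {X : Fin m → Type*} (θ : ℕ → ∀ i, X i) (n : ℕ) (i : Fin m) :
    mixPt θ n i (θ n i) = pre θ n (i + 1) := by
  funext j
  by_cases h : j = i
  · subst h; simp [mixPt, pre]
  · have h' : (j : ℕ) ≠ i := fun h1 => h (Fin.ext h1)
    have : (j : ℕ) < i + 1 ↔ (j : ℕ) < i := by omega
    simp [mixPt, pre, h, this]

theorem aux_descent {m : ℕ} {E : Fin m → Type*} [∀ i, NormedAddCommGroup (E i)]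
    (f : (∀ i, E i) → ℝ) (θ : ℕ → ∀ i, E i) (n : ℕ) (c D : ℝ)
    (h : ∀ i, f (mixPt θ n i (θ n i)) + c * ‖θ n i - θ (n - 1) i‖ ^ 2
      ≤ f (mixPt θ n i (θ (n - 1) i)) + D) :
    f (θ n) + c * ∑ i, ‖θ n i - θ (n - 1) i‖ ^ 2 ≤ f (θ (n - 1)) + m * D := by
  have h1 : ∑ i : Fin m, c * ‖θ n i - θ (n - 1) i‖ ^ 2
      ≤ ∑ i : Fin m, (D - (f (pre θ n (i + 1)) - f (pre θ n i))) := by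
    refine Finset.sum_le_sum (fun i _ => ?_)
    have := h i
    rw [mix_old, mix_new] at this
    linarith
  rw [Finset.sum_sub_distrib, ← Finset.mul_sum,
    Fin.sum_univ_eq_sum_range (fun k => f (pre θ n (k + 1)) - f (pre θ n k)) m,
    Finset.sum_range_sub (fun k => f (pre θ n k))] at h1
  have h2 : pre θ n m = θ n := by funext j; simp [pre]
  have h3 : pre θ n 0 = θ (n - 1) := by funext j; simp [pre]
  rw [h2, h3] at h1
  simp at h1
  linarith

theorem aux_block {m : ℕ} {E : Fin m → Type*} [∀ i, NormedAddCommGroup (E i)]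
    [∀ i, InnerProductSpace ℝ (E i)] [∀ i, CompleteSpace (E i)]
    (f : (∀ i, E i) → ℝ) (hf : Differentiable ℝ f) (Lf Lg D t : ℝ) (hLf : 0 ≤ Lf) (hLg : 0 ≤ Lg)
    (ht : 0 < t) (ht1 : t ≤ 1)
    (hLip : ∀ x y : ∀ i, E i,
          Real.sqrt (∑ i, ‖gradi f x i - gradi f y i‖ ^ 2)
            ≤ Lf * Real.sqrt (∑ i, ‖x i - y i‖ ^ 2))
    (θ : ℕ → ∀ i, E i) (n : ℕ) (i : Fin m) (g : E i → ℝ) (hg : Differentiable ℝ g)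
    (hgL : ∀ u v : E i, ‖gradient g u - gradient g v‖ ≤ Lg * ‖u - v‖)
    (K : Set (E i)) (hK : Convex ℝ K) (hx : θ n i ∈ K)
    (hmaj : ∀ v, f (mixPt θ n i v) ≤ g v)
    (heq : g (θ (n - 1) i) = f (mixPt θ n i (θ (n - 1) i)))
    (hmin : ∀ v ∈ K, g (θ n i) ≤ g v + D) :
    sSup ((fun u => ⟪-gradi f (θ n) i, u⟫) '' {u : E i | ‖u‖ ≤ 1 ∧ θ n i + u ∈ K})
      ≤ D / t + Lg * t + (Lg + Lf) * Real.sqrt (∑ i, ‖θ n i - θ (n - 1) i‖ ^ 2) := by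
  set d := Real.sqrt (∑ i, ‖θ n i - θ (n - 1) i‖ ^ 2) with hd
  refine csSup_le ⟨_, ⟨0, ⟨by simp, by simpa using hx⟩, rfl⟩⟩ ?_
  rintro _ ⟨u, ⟨hu, hxu⟩, rfl⟩
  have h1 := aux_stat g hg Lg D t hLg ht ht1 hgL K hK _ hx hmin u hu hxu
  have hdiff : Differentiable ℝ (fun v => f (mixPt θ n i v)) := by
    intro v
    exact (hf _).comp v (hasFDerivAt_update _ v).differentiableAt
  have htan := aux_tangent g _ hg hdiff hmaj _ heq
  have hgi : gradi f (mixPt θ n i (θ (n - 1) i)) i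
      = gradient (fun v => f (mixPt θ n i v)) (θ (n - 1) i) := by
    simp [gradi, mixPt]
  have hi : ‖θ n i - θ (n - 1) i‖ ≤ d := by
    refine Real.le_sqrt_of_sq_le ?_
    exact Finset.single_le_sum (f := fun i => ‖θ n i - θ (n - 1) i‖ ^ 2)
      (fun j _ => by positivity) (Finset.mem_univ i)
  have h2 : ‖gradient g (θ n i) - gradient g (θ (n - 1) i)‖ ≤ Lg * d :=
    (hgL _ _).trans (by gcongr)
  have h3 : ‖gradi f (mixPt θ n i (θ (n - 1) i)) i - gradi f (θ n) i‖ ≤ Lf * d := by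
    have h4 := hLip (mixPt θ n i (θ (n - 1) i)) (θ n)
    have h5 : ‖gradi f (mixPt θ n i (θ (n - 1) i)) i - gradi f (θ n) i‖ ≤
        Real.sqrt (∑ j, ‖gradi f (mixPt θ n i (θ (n - 1) i)) j - gradi f (θ n) j‖ ^ 2) := by
      refine Real.le_sqrt_of_sq_le ?_
      exact Finset.single_le_sum
        (f := fun j => ‖gradi f (mixPt θ n i (θ (n - 1) i)) j - gradi f (θ n) j‖ ^ 2)
        (fun j _ => by positivity) (Finset.mem_univ i)
    refine h5.trans (h4.trans ?_)
    refine mul_le_mul_of_nonneg_left (Real.sqrt_le_sqrt (Finset.sum_le_sum fun j _ => ?_)) hLf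
    rw [mix_old]
    by_cases hj : (j : ℕ) < i
    · simp [pre, hj]
    · simp only [pre, hj, if_false]
      rw [norm_sub_rev]
  rw [hgi, ← htan] at h3
  have h6 : ⟪-gradi f (θ n) i, u⟫ = ⟪-gradient g (θ n i), u⟫
      + ⟪gradient g (θ n i) - gradient g (θ (n - 1) i), u⟫
      + ⟪gradient g (θ (n - 1) i) - gradi f (θ n) i, u⟫ := by
    rw [← inner_add_left, ← inner_add_left]
    congr 1
    abel
  have h7 : ∀ a : E i, ⟪a, u⟫ ≤ ‖a‖ := fun a =>
    (real_inner_le_norm a u).trans (mul_le_of_le_one_right (norm_nonneg _) hu)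
  have h8 := h7 (gradient g (θ n i) - gradient g (θ (n - 1) i))
  have h9 := h7 (gradient g (θ (n - 1) i) - gradi f (θ n) i)
  show ⟪-gradi f (θ n) i, u⟫ ≤ _
  rw [h6]
  linarith

theorem aux_pick (a : ℕ → ℝ) (n : ℕ) (hn : 1 ≤ n) (B : ℝ)
    (h : ∑ k ∈ Finset.range n, a (k + 1) ≤ B) : ∃ k ∈ Finset.Icc 1 n, a k ≤ B / n := by
  have hne : (Finset.range n).Nonempty := ⟨0, by simp; omega⟩
  have hn0 : (0 : ℝ) < n := by exact_mod_cast hn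
  obtain ⟨k, hk, hk'⟩ := Finset.exists_le_of_sum_le (s := Finset.range n)
    (f := fun k => a (k + 1)) (g := fun _ => B / n) hne (by
      simp only [Finset.sum_const, Finset.card_range, nsmul_eq_mul]
      rwa [mul_div_cancel₀ _ hn0.ne'])
  exact ⟨k + 1, by simp at hk ⊢; omega, hk'⟩

theorem aux_num (n : ℕ) (hn : 2 ≤ n) : 1 / Real.sqrt n
    ≤ 1 / Real.sqrt (Real.log 2) * (Real.sqrt (Real.log n) / (n : ℝ) ^ ((1 : ℝ) / 4)) := by
  have hn1 : (1 : ℝ) ≤ n := by exact_mod_cast (by omega : 1 ≤ n)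
  have hn2 : (2 : ℝ) ≤ n := by exact_mod_cast hn
  have hl : 0 < Real.log 2 := Real.log_pos (by norm_num)
  have hs : 0 < Real.sqrt (Real.log 2) := Real.sqrt_pos.mpr hl
  have h1 : Real.sqrt (Real.log 2) ≤ Real.sqrt (Real.log n) :=
    Real.sqrt_le_sqrt (Real.log_le_log (by norm_num) hn2)
  have hp : 0 < (n : ℝ) ^ ((1 : ℝ) / 4) := Real.rpow_pos_of_pos (by linarith) _
  have h2 : (n : ℝ) ^ ((1 : ℝ) / 4) ≤ Real.sqrt n := by
    rw [Real.sqrt_eq_rpow]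
    exact Real.rpow_le_rpow_of_exponent_le hn1 (by norm_num)
  calc 1 / Real.sqrt n ≤ 1 / (n : ℝ) ^ ((1 : ℝ) / 4) := one_div_le_one_div_of_le hp h2
    _ ≤ (Real.sqrt (Real.log n) / Real.sqrt (Real.log 2)) / (n : ℝ) ^ ((1 : ℝ) / 4) := by
        gcongr
        rwa [one_le_div hs]
    _ = _ := by ring

/-- rate of convergence of BMM with `L_g`-smooth surrogates and quadratic
majorization gaps.  There is a constant `C > 0` depending only on `m`, `L_f`, `L_g` and
`c` such that for any such BMM sequence with summable optimality gaps, for every `n ≥ 2`: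
`min_{1≤k≤n} S(θ_k) ≤ C (f(θ_0) - f* + 1 + ∑_j Δ_j) (log n)^{1/2}/n^{1/4}`. -/
theorem bmm_smooth_surrogates_complexity (m : ℕ) (hm : 1 ≤ m) (Lf Lg c : ℝ)
    (hLf : 0 < Lf) (hLg : 0 ≤ Lg) (hc : 0 < c) :
    ∃ C : ℝ, 0 < C ∧
      ∀ (E : Fin m → Type u)
        [∀ i, NormedAddCommGroup (E i)] [∀ i, InnerProductSpace ℝ (E i)]
        [∀ i, FiniteDimensional ℝ (E i)]
        (Θ : ∀ i, Set (E i)),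
        (∀ i, (Θ i).Nonempty) → (∀ i, IsClosed (Θ i)) → (∀ i, Convex ℝ (Θ i)) →
        ∀ f : (∀ i, E i) → ℝ, Differentiable ℝ f →
        (∀ x y : ∀ i, E i,
          Real.sqrt (∑ i, ‖gradi f x i - gradi f y i‖ ^ 2)
            ≤ Lf * Real.sqrt (∑ i, ‖x i - y i‖ ^ 2)) →
        ∀ fstar : ℝ, (∀ x, fstar ≤ f x) →
        ∀ θ : ℕ → ∀ i, E i, (∀ n i, θ n i ∈ Θ i) →
        ∀ g : ℕ → ∀ i : Fin m, E i → ℝ,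
        ∀ Δ : ℕ → ℝ, (∀ n, 1 ≤ n → 0 ≤ Δ n) → (Summable fun n => Δ (n + 1)) →
        (∀ n, 1 ≤ n → ∀ i, ∀ v : E i, f (mixPt θ n i v) ≤ g n i v) →
        (∀ n, 1 ≤ n → ∀ i, g n i (θ (n - 1) i) = f (mixPt θ n i (θ (n - 1) i))) →
        (∀ n, 1 ≤ n → ∀ i, ∀ v ∈ Θ i, g n i (θ n i) ≤ g n i v + Δ n) →
        (∀ n, 1 ≤ n → ∀ i, Differentiable ℝ (g n i)) →
        (∀ n, 1 ≤ n → ∀ i, ∀ u v : E i,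
          ‖gradient (g n i) u - gradient (g n i) v‖ ≤ Lg * ‖u - v‖) →
        (∀ n, 1 ≤ n → ∀ i, ∀ v : E i,
          c * ‖v - θ (n - 1) i‖ ^ 2 ≤ g n i v - f (mixPt θ n i v)) →
        ∀ n : ℕ, ∀ hn : 2 ≤ n,
          (Finset.Icc 1 n).inf'
              ⟨1, Finset.mem_Icc.mpr ⟨le_refl 1, le_trans one_le_two hn⟩⟩
              (fun k => Smeasure f Θ (θ k))
            ≤ C * (f (θ 0) - fstar + 1 + ∑' j, Δ (j + 1)) *
                Real.sqrt (Real.log n) / (n : ℝ) ^ ((1 : ℝ) / 4) := by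
  have hm0 : (1 : ℝ) ≤ m := by exact_mod_cast hm
  have hl : 0 < Real.sqrt (Real.log 2) := Real.sqrt_pos.mpr (Real.log_pos (by norm_num))
  set C0 : ℝ := m * ((m + 1) + Lg + (Lg + Lf) * Real.sqrt ((m + 1) / c)) with hC0
  have hC0pos : 0 < C0 := by positivity
  refine ⟨C0 * (1 / Real.sqrt (Real.log 2)), by positivity, ?_⟩
  intro E _ _ _ Θ _ _ hconv f hf hLip fstar hstar θ hθ g Δ hΔ hsum hmaj heq hmin hgd hgL hgap n hn
  set T := ∑' j, Δ (j + 1) with hT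
  have hT0 : 0 ≤ T := tsum_nonneg fun j => hΔ _ (by omega)
  set M := f (θ 0) - fstar + 1 + T with hM
  have hM1 : 1 ≤ M := by have := hstar (θ 0); linarith
  have hn0 : (0 : ℝ) < n := by exact_mod_cast (by omega : 0 < n)
  have hn1 : (1 : ℝ) ≤ n := by exact_mod_cast (by omega : 1 ≤ n)
  -- descent
  have hdes : ∀ k, 1 ≤ k → f (θ k) + c * ∑ i, ‖θ k i - θ (k - 1) i‖ ^ 2
      ≤ f (θ (k - 1)) + m * Δ k := by
    intro k hk
    refine aux_descent f θ k c (Δ k) (fun i => ?_)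
    have h1 := hgap k hk i (θ k i)
    have h2 := hmin k hk i _ (hθ (k - 1) i)
    have h3 := heq k hk i
    linarith
  have htel : ∑ k ∈ Finset.range n, (c * ∑ i, ‖θ (k + 1) i - θ (k + 1 - 1) i‖ ^ 2 + Δ (k + 1))
      ≤ (m + 1) * M := by
    have h1 : ∑ k ∈ Finset.range n, (c * ∑ i, ‖θ (k + 1) i - θ (k + 1 - 1) i‖ ^ 2 + Δ (k + 1))
        ≤ ∑ k ∈ Finset.range n, ((m + 1) * Δ (k + 1) - (f (θ (k + 1)) - f (θ k))) := by
      refine Finset.sum_le_sum fun k _ => ?_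
      have := hdes (k + 1) (by omega)
      simp only [Nat.add_sub_cancel] at this ⊢
      linarith
    rw [Finset.sum_sub_distrib, ← Finset.mul_sum, Finset.sum_range_sub (fun k => f (θ k))] at h1
    have h2 : ∑ k ∈ Finset.range n, Δ (k + 1) ≤ T :=
      hsum.sum_le_tsum _ fun j _ => hΔ _ (by omega)
    have h3 := hstar (θ n)
    have h4 := hstar (θ 0)
    have h5 : ((m : ℝ) + 1) * ∑ k ∈ Finset.range n, Δ (k + 1) ≤ (m + 1) * T := by gcongr
    have h6 : f (θ 0) - fstar + 1 ≤ (m + 1) * (f (θ 0) - fstar + 1) := by nlinarith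
    have h7 : ((m : ℝ) + 1) * M = (m + 1) * (f (θ 0) - fstar + 1) + (m + 1) * T := by
      rw [hM]; ring
    linarith
  obtain ⟨k, hk, hak⟩ := aux_pick (fun k => c * ∑ i, ‖θ k i - θ (k - 1) i‖ ^ 2 + Δ k) n
    (by omega) _ htel
  have hk1 : 1 ≤ k := (Finset.mem_Icc.mp hk).1
  have hΔk := hΔ k hk1
  have hSnn : 0 ≤ ∑ i, ‖θ k i - θ (k - 1) i‖ ^ 2 := by positivity
  set Q := ∑ i, ‖θ k i - θ (k - 1) i‖ ^ 2 with hQ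
  have hQle : Q ≤ (m + 1) / c * (M / Real.sqrt n) ^ 2 := by
    have h1 : c * Q ≤ (m + 1) * M / n := by linarith
    have h2 : (m + 1) * M / n ≤ (m + 1) * (M / Real.sqrt n) ^ 2 := by
      rw [div_pow, Real.sq_sqrt hn0.le, mul_div_assoc]
      gcongr
      nlinarith
    rw [div_mul_eq_mul_div, le_div_iff₀ hc]
    linarith
  have hdle : Real.sqrt Q ≤ Real.sqrt ((m + 1) / c) * (M / Real.sqrt n) := by
    refine (Real.sqrt_le_sqrt hQle).trans (le_of_eq ?_)
    rw [Real.sqrt_mul (by positivity), Real.sqrt_sq (by positivity)]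
  have hsn : 0 < Real.sqrt n := Real.sqrt_pos.mpr hn0
  have hsn1 : 1 ≤ Real.sqrt n := Real.one_le_sqrt.mpr hn1
  have hDt : Δ k / (1 / Real.sqrt n) ≤ (m + 1) * (M / Real.sqrt n) := by
    have h1 : Δ k ≤ (m + 1) * M / n := by
      have : 0 ≤ c * Q := by positivity
      linarith
    rw [div_div_eq_mul_div, div_one]
    calc Δ k * Real.sqrt n ≤ (m + 1) * M / n * Real.sqrt n := by gcongr
      _ = (m + 1) * M / (Real.sqrt n * Real.sqrt n) * Real.sqrt n := by
          rw [Real.mul_self_sqrt hn0.le]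
      _ = _ := by field_simp
  have hLt : Lg * (1 / Real.sqrt n) ≤ Lg * (M / Real.sqrt n) := by gcongr
  have hS : Smeasure f Θ (θ k) ≤ C0 * (M * (1 / Real.sqrt n)) := by
    have h1 : Smeasure f Θ (θ k) ≤ ∑ _i : Fin m, (Δ k / (1 / Real.sqrt n)
        + Lg * (1 / Real.sqrt n) + (Lg + Lf) * Real.sqrt Q) := by
      refine Finset.sum_le_sum fun i _ => ?_
      exact aux_block f hf Lf Lg (Δ k) (1 / Real.sqrt n) hLf.le hLg (by positivity)
        (by rw [div_le_one hsn]; exact hsn1) hLip θ k i (g k i) (hgd k hk1 i) (hgL k hk1 i)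
        (Θ i) (hconv i) (hθ k i) (hmaj k hk1 i) (heq k hk1 i) (hmin k hk1 i)
    rw [Finset.sum_const, Finset.card_univ, Fintype.card_fin, nsmul_eq_mul] at h1
    refine h1.trans ?_
    have h2 : (Lg + Lf) * Real.sqrt Q
        ≤ (Lg + Lf) * (Real.sqrt ((m + 1) / c) * (M / Real.sqrt n)) := by gcongr
    calc (m : ℝ) * (Δ k / (1 / Real.sqrt n) + Lg * (1 / Real.sqrt n) + (Lg + Lf) * Real.sqrt Q)
        ≤ m * ((m + 1) * (M / Real.sqrt n) + Lg * (M / Real.sqrt n)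
          + (Lg + Lf) * (Real.sqrt ((m + 1) / c) * (M / Real.sqrt n))) := by gcongr
      _ = _ := by rw [hC0]; ring
  refine (Finset.inf'_le _ hk).trans (hS.trans ?_)
  have hfin := aux_num n hn
  calc C0 * (M * (1 / Real.sqrt n)) ≤ C0 * (M * (1 / Real.sqrt (Real.log 2)
        * (Real.sqrt (Real.log n) / (n : ℝ) ^ ((1 : ℝ) / 4)))) := by gcongr
    _ = _ := by ring
end

section
/- Suppose (θ_n)_{n≥1} is a BMM sequence with surrogates (g_n^i) and optimality gaps (Δ_n) for f started at θ_0, where each g_n^i is differentiable with L_g-Lipschitz gradient for a common constant L_g ≥ 0, there are constants c, C₀ > 0 with c·‖θ − θ_{n−1}^i‖² ≤ g_n^i(θ) − f_n^i(θ) ≤ C₀·‖θ − θ_{n−1}^i‖² for all n, i and θ ∈ E_i, and Σ_{n≥1} Δ_n < ∞. Then there is a constant C > 0, depending only on m, L_f, L_g, c and C₀, such that for every n ≥ 2: min_{1≤k≤n} S(θ_k) ≤ C·( f(θ_0) − f* + 1 + Σ_{j=1}^∞ Δ_j )·(log n)^{1/2}/n^{1/2}. -/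
open Filter RealInnerProductSpace

universe u

theorem bmm_aux_descent {E : Type*} [NormedAddCommGroup E] [InnerProductSpace ℝ E]
    [CompleteSpace E] (g : E → ℝ) (hg : Differentiable ℝ g) (L : ℝ) (hL : 0 ≤ L)
    (hLip : ∀ u v, ‖gradient g u - gradient g v‖ ≤ L * ‖u - v‖)
    (x u : E) (hu : ‖u‖ ≤ 1) (t : ℝ) (ht : 0 < t) :
    g (x + t • u) ≤ g x + t * ⟪gradient g x, u⟫ + L * t ^ 2 := by
  have hd : ∀ s : ℝ, HasDerivAt (fun s : ℝ => g (x + s • u)) ⟪gradient g (x + s • u), u⟫ s := by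
    intro s
    have h1 : HasDerivAt (fun s : ℝ => x + s • u) u s := by
      simpa using ((hasDerivAt_id s).smul_const u).const_add x
    have h2 := (hg (x + s • u)).hasGradientAt.hasFDerivAt.comp_hasDerivAt s h1
    simpa [Function.comp_def] using h2
  obtain ⟨s, hs, hs2⟩ := exists_hasDerivAt_eq_slope (fun s : ℝ => g (x + s • u))
    (fun s => ⟪gradient g (x + s • u), u⟫) ht
    (fun s _ => (hd s).continuousAt.continuousWithinAt) (fun s _ => hd s)
  simp only [zero_smul, add_zero, sub_zero] at hs2
  rw [eq_div_iff ht.ne'] at hs2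
  have h3 : ⟪gradient g (x + s • u) - gradient g x, u⟫ ≤ L * t := by
    have hb := hLip (x + s • u) x
    rw [add_sub_cancel_left, norm_smul, Real.norm_of_nonneg hs.1.le] at hb
    calc _ ≤ ‖gradient g (x + s • u) - gradient g x‖ * ‖u‖ := real_inner_le_norm _ _
      _ ≤ ‖gradient g (x + s • u) - gradient g x‖ * 1 := by gcongr
      _ ≤ L * (s * ‖u‖) := by simpa using hb
      _ ≤ L * (t * 1) := by
        gcongr
        exact hs.2.le
      _ = L * t := by ring
  rw [inner_sub_left] at h3
  nlinarith

theorem bmm_aux_step {m : ℕ} {E : Fin m → Type*} [∀ i, NormedAddCommGroup (E i)]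
    (f : (∀ i, E i) → ℝ) (θ : ℕ → ∀ i, E i) (n : ℕ) (c δ : ℝ)
    (h : ∀ i, f (mixPt θ n i (θ n i)) ≤ f (mixPt θ n i (θ (n - 1) i)) + δ
      - c * ‖θ n i - θ (n - 1) i‖ ^ 2) :
    f (θ n) ≤ f (θ (n - 1)) + m * δ - c * ∑ i, ‖θ n i - θ (n - 1) i‖ ^ 2 := by
  set w : ℕ → ∀ i, E i := fun k j => if (j : ℕ) < k then θ n j else θ (n - 1) j with hw
  have e0 : w 0 = θ (n - 1) := by ext j; simp [hw]
  have em : w m = θ n := by ext j; simp [hw]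
  have e1 : ∀ i : Fin m, mixPt θ n i (θ (n - 1) i) = w i := by
    intro i; ext j
    by_cases hj : j = i
    · subst hj; simp [mixPt, hw]
    · simp [mixPt, hw, hj]
  have e2 : ∀ i : Fin m, mixPt θ n i (θ n i) = w (i + 1) := by
    intro i; ext j
    by_cases hj : j = i
    · subst hj; simp [mixPt, hw]
    · have : (j : ℕ) ≠ i := fun h => hj (Fin.ext h)
      have h3 : ((j : ℕ) < i + 1) ↔ ((j : ℕ) < i) := by omega
      simp only [mixPt, hw, Function.update_of_ne hj, h3]
  have hs : ∑ i : Fin m, (f (w (i + 1)) - f (w i)) = f (w m) - f (w 0) := by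
    rw [Fin.sum_univ_eq_sum_range (fun i => f (w (i + 1)) - f (w i)) m]
    exact Finset.sum_range_sub (fun i => f (w i)) m
  have hle : ∑ i : Fin m, (f (w (i + 1)) - f (w i))
      ≤ ∑ i : Fin m, (δ - c * ‖θ n i - θ (n - 1) i‖ ^ 2) := by
    refine Finset.sum_le_sum fun i _ => ?_
    have := h i
    rw [e1, e2] at this
    linarith
  rw [hs, e0, em, Finset.sum_sub_distrib, ← Finset.mul_sum] at hle
  simp at hle
  linarith

theorem bmm_aux_stat {m : ℕ} {E : Fin m → Type*} [∀ i, NormedAddCommGroup (E i)]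
    [∀ i, InnerProductSpace ℝ (E i)] [∀ i, CompleteSpace (E i)]
    (Lf Lg δ : ℝ) (hLf : 0 < Lf) (hLg : 0 ≤ Lg)
    (Θ : ∀ i, Set (E i)) (hconv : ∀ i, Convex ℝ (Θ i))
    (f : (∀ i, E i) → ℝ) (hf : Differentiable ℝ f)
    (hlip : ∀ x y : ∀ i, E i, Real.sqrt (∑ i, ‖gradi f x i - gradi f y i‖ ^ 2)
            ≤ Lf * Real.sqrt (∑ i, ‖x i - y i‖ ^ 2))
    (θ : ℕ → ∀ i, E i) (hθ : ∀ n i, θ n i ∈ Θ i) (n : ℕ) (i : Fin m) (g : E i → ℝ)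
    (hmaj : ∀ v, f (mixPt θ n i v) ≤ g v)
    (heq : g (θ (n - 1) i) = f (mixPt θ n i (θ (n - 1) i)))
    (hopt : ∀ v ∈ Θ i, g (θ n i) ≤ g v + δ)
    (hgd : Differentiable ℝ g)
    (hgl : ∀ u v, ‖gradient g u - gradient g v‖ ≤ Lg * ‖u - v‖)
    (t : ℝ) (ht : 0 < t) (ht1 : t ≤ 1) (u : E i) (hu : ‖u‖ ≤ 1) (hu2 : θ n i + u ∈ Θ i) :
    ⟪-gradi f (θ n) i, u⟫ ≤ (2 * Lf + Lg) * Real.sqrt (∑ j, ‖θ n j - θ (n - 1) j‖ ^ 2)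
      + Lg * t + δ / t := by
  set d := Real.sqrt (∑ j, ‖θ n j - θ (n - 1) j‖ ^ 2) with hd
  set F : E i → ℝ := fun v => f (mixPt θ n i v) with hF
  have hFd : Differentiable ℝ F := by
    intro v
    have := (hasFDerivAt_update (𝕜 := ℝ)
      (fun j : Fin m => if (j : ℕ) < (i : ℕ) then θ n j else θ (n - 1) j) (i := i) v).differentiableAt
    exact (hf _).comp v this
  have hFg : ∀ v, gradient F v = gradi f (mixPt θ n i v) i := by
    intro v
    simp only [gradi, hF, mixPt, Function.update_idem, Function.update_self]
  -- block Lipschitz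
  have hblk : ∀ x y : ∀ i, E i, ‖gradi f x i - gradi f y i‖
      ≤ Lf * Real.sqrt (∑ i, ‖x i - y i‖ ^ 2) := by
    intro x y
    refine le_trans (Real.le_sqrt_of_sq_le ?_) (hlip x y)
    exact Finset.single_le_sum (f := fun i => ‖gradi f x i - gradi f y i‖ ^ 2)
      (fun _ _ => by positivity) (Finset.mem_univ i)
  have hmono : ∀ x y : ∀ i, E i, (∀ j, ‖x j - y j‖ ≤ ‖θ n j - θ (n - 1) j‖) →
      ‖gradi f x i - gradi f y i‖ ≤ Lf * d := by
    intro x y hxy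
    refine (hblk x y).trans ?_
    rw [hd]
    gcongr with j
    exact hxy j
  have hdi : ‖θ n i - θ (n - 1) i‖ ≤ d := by
    refine Real.le_sqrt_of_sq_le ?_
    exact Finset.single_le_sum (f := fun j => ‖θ n j - θ (n - 1) j‖ ^ 2)
      (fun _ _ => by positivity) (Finset.mem_univ i)
  have hA : ‖gradi f (mixPt θ n i (θ n i)) i - gradi f (θ n) i‖ ≤ Lf * d := by
    apply hmono
    intro j
    by_cases hj : j = i
    · subst hj; simp [mixPt]
    · by_cases h2 : (j : ℕ) < i
      · simp only [mixPt, Function.update_of_ne hj, h2, if_true, sub_self, norm_zero]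
        positivity
      · simp only [mixPt, Function.update_of_ne hj, h2, if_false]
        rw [norm_sub_rev]
  have hB : ‖gradi f (mixPt θ n i (θ n i)) i - gradi f (mixPt θ n i (θ (n - 1) i)) i‖
      ≤ Lf * d := by
    apply hmono
    intro j
    by_cases hj : j = i
    · subst hj; simp [mixPt]
    · simp [mixPt, hj]
  have hC : ‖gradient g (θ n i) - gradient g (θ (n - 1) i)‖ ≤ Lg * d :=
    (hgl _ _).trans (by gcongr)
  have hZ : gradient g (θ (n - 1) i) = gradi f (mixPt θ n i (θ (n - 1) i)) i := by
    rw [← hFg]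
    have hmin : IsLocalMin (fun v => g v - F v) (θ (n - 1) i) := by
      refine Filter.Eventually.of_forall fun v => ?_
      have := hmaj v
      simp only [hF]
      rw [heq]
      linarith
    have h0 := hmin.fderiv_eq_zero
    rw [fderiv_fun_sub (hgd _) (hFd _), sub_eq_zero] at h0
    simp only [gradient, h0]
  have hD := bmm_aux_descent g hgd Lg hLg hgl (θ n i) u hu t ht
  have hmem : θ n i + t • u ∈ Θ i := (hconv i).add_smul_mem (hθ n i) hu2 ⟨ht.le, ht1⟩
  have hO := hopt _ hmem
  have hG : -⟪gradient g (θ n i), u⟫ ≤ Lg * t + δ / t := by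
    have : δ / t * t = δ := div_mul_cancel₀ _ ht.ne'
    by_contra hcon
    push Not at hcon
    nlinarith
  have hdec : -gradi f (θ n) i = (gradi f (mixPt θ n i (θ n i)) i - gradi f (θ n) i)
      - (gradi f (mixPt θ n i (θ n i)) i - gradi f (mixPt θ n i (θ (n - 1) i)) i)
      + (gradient g (θ n i) - gradient g (θ (n - 1) i)) - gradient g (θ n i) := by
    rw [hZ]; abel
  have hin : ∀ (a : E i) (b : ℝ), ‖a‖ ≤ b → |⟪a, u⟫| ≤ b := by
    intro a b hab
    calc _ ≤ ‖a‖ * ‖u‖ := abs_real_inner_le_norm _ _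
      _ ≤ ‖a‖ * 1 := by gcongr
      _ ≤ b := by simpa using hab
  have h1 := abs_le.1 (hin _ _ hA)
  have h2 := abs_le.1 (hin _ _ hB)
  have h3 := abs_le.1 (hin _ _ hC)
  rw [hdec, inner_sub_left, inner_add_left, inner_sub_left]
  linarith [h1.2, h2.1, h3.2]

/-- optimal rate of convergence of BMM with `L_g`-smooth surrogates and two-sided quadratic
majorization gaps `c‖θ - θ_{n-1}^i‖² ≤ g_n^i(θ) - f_n^i(θ) ≤ C₀‖θ - θ_{n-1}^i‖²`.  There
is a constant `C > 0` depending only on `m`, `L_f`, `L_g`, `c` and `C₀` such that for any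
such BMM sequence with summable optimality gaps, for every `n ≥ 2`:
`min_{1≤k≤n} S(θ_k) ≤ C (f(θ_0) - f* + 1 + ∑_j Δ_j) (log n)^{1/2}/n^{1/2}`. -/
theorem bmm_smooth_surrogates_optimal_complexity (m : ℕ) (hm : 1 ≤ m) (Lf Lg c C₀ : ℝ)
    (hLf : 0 < Lf) (hLg : 0 ≤ Lg) (hc : 0 < c) (hC₀ : 0 < C₀) :
    ∃ C : ℝ, 0 < C ∧
      ∀ (E : Fin m → Type u)
        [∀ i, NormedAddCommGroup (E i)] [∀ i, InnerProductSpace ℝ (E i)]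
        [∀ i, FiniteDimensional ℝ (E i)]
        (Θ : ∀ i, Set (E i)),
        (∀ i, (Θ i).Nonempty) → (∀ i, IsClosed (Θ i)) → (∀ i, Convex ℝ (Θ i)) →
        ∀ f : (∀ i, E i) → ℝ, Differentiable ℝ f →
        (∀ x y : ∀ i, E i,
          Real.sqrt (∑ i, ‖gradi f x i - gradi f y i‖ ^ 2)
            ≤ Lf * Real.sqrt (∑ i, ‖x i - y i‖ ^ 2)) →
        ∀ fstar : ℝ, (∀ x, fstar ≤ f x) →
        ∀ θ : ℕ → ∀ i, E i, (∀ n i, θ n i ∈ Θ i) →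
        ∀ g : ℕ → ∀ i : Fin m, E i → ℝ,
        ∀ Δ : ℕ → ℝ, (∀ n, 1 ≤ n → 0 ≤ Δ n) → (Summable fun n => Δ (n + 1)) →
        (∀ n, 1 ≤ n → ∀ i, ∀ v : E i, f (mixPt θ n i v) ≤ g n i v) →
        (∀ n, 1 ≤ n → ∀ i, g n i (θ (n - 1) i) = f (mixPt θ n i (θ (n - 1) i))) →
        (∀ n, 1 ≤ n → ∀ i, ∀ v ∈ Θ i, g n i (θ n i) ≤ g n i v + Δ n) →
        (∀ n, 1 ≤ n → ∀ i, Differentiable ℝ (g n i)) →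
        (∀ n, 1 ≤ n → ∀ i, ∀ u v : E i,
          ‖gradient (g n i) u - gradient (g n i) v‖ ≤ Lg * ‖u - v‖) →
        (∀ n, 1 ≤ n → ∀ i, ∀ v : E i,
          c * ‖v - θ (n - 1) i‖ ^ 2 ≤ g n i v - f (mixPt θ n i v)) →
        (∀ n, 1 ≤ n → ∀ i, ∀ v : E i,
          g n i v - f (mixPt θ n i v) ≤ C₀ * ‖v - θ (n - 1) i‖ ^ 2) →
        ∀ n : ℕ, ∀ hn : 2 ≤ n,
          (Finset.Icc 1 n).inf'
              ⟨1, Finset.mem_Icc.mpr ⟨le_refl 1, le_trans one_le_two hn⟩⟩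
              (fun k => Smeasure f Θ (θ k))
            ≤ C * (f (θ 0) - fstar + 1 + ∑' j, Δ (j + 1)) *
                Real.sqrt (Real.log n) / Real.sqrt n := by
  have hm' : (1 : ℝ) ≤ m := by exact_mod_cast hm
  set K := 2 * Lf + Lg with hK
  have hKpos : 0 < K := by positivity
  refine ⟨2 * m * (K * (1 + m / c) + Lg + 1), by positivity, ?_⟩
  intro E _ _ _ Θ hne hcl hconv f hf hlip fstar hstar θ hθ g Δ hΔ hsum hmaj heq hopt hgd hgl
    hlow hup N hN
  set D : ℕ → ℝ := fun k => ∑ i, ‖θ k i - θ (k - 1) i‖ ^ 2 with hD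
  have hD0 : ∀ k, 0 ≤ D k := fun k => Finset.sum_nonneg fun _ _ => by positivity
  set T := ∑' j, Δ (j + 1) with hT
  have hT0 : 0 ≤ T := tsum_nonneg fun j => hΔ _ (by omega)
  have hstep : ∀ k, 1 ≤ k → f (θ k) ≤ f (θ (k - 1)) + m * Δ k - c * D k := by
    intro k hk
    apply bmm_aux_step
    intro i
    have h1 := hlow k hk i (θ k i)
    have h2 := hopt k hk i _ (hθ (k - 1) i)
    rw [heq k hk i] at h2
    linarith
  have htel : ∀ k : ℕ, c * ∑ j ∈ Finset.range k, D (j + 1) ≤ f (θ 0) - f (θ k)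
      + m * ∑ j ∈ Finset.range k, Δ (j + 1) := by
    intro k
    induction k with
    | zero => simp
    | succ k ih =>
      rw [Finset.sum_range_succ, Finset.sum_range_succ]
      have := hstep (k + 1) (by omega)
      simp only [Nat.add_sub_cancel] at this
      linarith
  have hΔT : ∑ j ∈ Finset.range N, Δ (j + 1) ≤ T :=
    hsum.sum_le_tsum _ fun j _ => hΔ _ (by omega)
  set Q := f (θ 0) - fstar + 1 + T with hQ
  have hf0 := hstar (θ 0)
  have hQ1 : 1 ≤ Q := by linarith
  have hDQ : ∑ j ∈ Finset.range N, D (j + 1) ≤ m / c * Q := by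
    rw [div_mul_eq_mul_div, le_div_iff₀ hc]
    have h1 := htel N
    have h2 := hstar (θ N)
    nlinarith [mul_le_mul_of_nonneg_left hΔT (by linarith : (0 : ℝ) ≤ m)]
  have hNpos : (0 : ℝ) < N := by exact_mod_cast (by omega : 0 < N)
  set r := Real.sqrt N with hr
  have hrpos : 0 < r := Real.sqrt_pos.2 hNpos
  have hr1 : 1 ≤ r := Real.one_le_sqrt.2 (by exact_mod_cast (by omega : 1 ≤ N))
  have hrr : r * r = N := Real.mul_self_sqrt hNpos.le
  have hS : ∀ k, 1 ≤ k → Smeasure f Θ (θ k)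
      ≤ m * (K * (1 / r + r * D k) + Lg / r + r * Δ k) := by
    intro k hk
    have hb : ∀ i ∈ (Finset.univ : Finset (Fin m)),
        sSup ((fun u => ⟪-gradi f (θ k) i, u⟫) '' {u : E i | ‖u‖ ≤ 1 ∧ θ k i + u ∈ Θ i})
        ≤ K * (1 / r + r * D k) + Lg / r + r * Δ k := by
      intro i _
      have hk0 := hΔ k hk
      have hDk := hD0 k
      apply Real.sSup_le
      · rintro _ ⟨u, ⟨hu, hu2⟩, rfl⟩
        have h := bmm_aux_stat Lf Lg (Δ k) hLf hLg Θ hconv f hf hlip θ hθ k i (g k i)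
          (hmaj k hk i) (heq k hk i) (hopt k hk i) (hgd k hk i) (hgl k hk i) (1 / r)
          (by positivity) ((div_le_one hrpos).2 hr1) u hu hu2
        have hsq : Real.sqrt (D k) ≤ 1 / r + r * D k := by
          have h1 : Real.sqrt (D k) * Real.sqrt (D k) = D k := Real.mul_self_sqrt hDk
          have h2 : (1 / r) * r = 1 := by field_simp
          have h3 : 0 ≤ 1 / r := by positivity
          have h4 : 1 / r + r * D k - 2 * Real.sqrt (D k)
              = r * (Real.sqrt (D k) - 1 / r) ^ 2 := by
            have h9 : ∀ q : ℝ, 1 / r + r * (q * q) - 2 * q = r * (q - 1 / r) ^ 2 := by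
              intro q; field_simp; ring
            have := h9 (Real.sqrt (D k))
            rwa [h1] at this
          have h5 : 0 ≤ r * (Real.sqrt (D k) - 1 / r) ^ 2 := by positivity
          linarith [Real.sqrt_nonneg (D k)]
        have h6 := mul_le_mul_of_nonneg_left hsq hKpos.le
        have h7 : Δ k / (1 / r) = r * Δ k := by field_simp
        have h8 : Lg * (1 / r) = Lg / r := by ring
        rw [h7, h8] at h
        refine h.trans ?_
        linarith
      · positivity
    have := Finset.sum_le_sum hb
    rw [Finset.sum_const, Finset.card_univ, Fintype.card_fin, nsmul_eq_mul] at this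
    exact this
  set I := (Finset.Icc 1 N).inf'
              ⟨1, Finset.mem_Icc.mpr ⟨le_refl 1, le_trans one_le_two hN⟩⟩
              (fun k => Smeasure f Θ (θ k)) with hI
  have hIle : ∀ j ∈ Finset.range N, I
      ≤ m * (K * (1 / r + r * D (j + 1)) + Lg / r + r * Δ (j + 1)) := by
    intro j hj
    have hj' := Finset.mem_range.1 hj
    exact (Finset.inf'_le _ (Finset.mem_Icc.2 ⟨by omega, by omega⟩)).trans (hS (j + 1) (by omega))
  have hsumI := Finset.sum_le_sum hIle
  have hexp : ∑ j ∈ Finset.range N,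
      (m : ℝ) * (K * (1 / r + r * D (j + 1)) + Lg / r + r * Δ (j + 1))
      = m * (K * (N / r + r * ∑ j ∈ Finset.range N, D (j + 1)) + N * (Lg / r)
        + r * ∑ j ∈ Finset.range N, Δ (j + 1)) := by
    rw [← Finset.mul_sum, Finset.sum_add_distrib, Finset.sum_add_distrib, ← Finset.mul_sum,
      Finset.sum_add_distrib, ← Finset.mul_sum, ← Finset.mul_sum]
    simp [div_eq_mul_inv]
  rw [hexp] at hsumI
  simp only [Finset.sum_const, Finset.card_range, nsmul_eq_mul] at hsumI
  have hNr : (N : ℝ) / r = r := by rw [← hrr]; field_simp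
  have hNL : (N : ℝ) * (Lg / r) = r * Lg := by rw [← hrr]; field_simp
  rw [hNr, hNL, ← hrr] at hsumI
  have hIr : I * r ≤ m * (K * (1 + m / c) + Lg + 1) * Q := by
    have h1 : r * (I * r) ≤ r * (m * (K * (1 + ∑ j ∈ Finset.range N, D (j + 1)) + Lg
        + ∑ j ∈ Finset.range N, Δ (j + 1))) := by
      refine le_trans (le_of_eq ?_) (hsumI.trans (le_of_eq ?_)) <;> ring
    have h2 := le_of_mul_le_mul_left h1 hrpos
    refine h2.trans ?_
    rw [mul_assoc]
    refine mul_le_mul_of_nonneg_left ?_ (by linarith)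
    have h3 : K * (1 + ∑ j ∈ Finset.range N, D (j + 1)) ≤ K * (Q + m / c * Q) := by
      gcongr
    have h4 : Lg ≤ Lg * Q := le_mul_of_one_le_right hLg hQ1
    have h5 : ∑ j ∈ Finset.range N, Δ (j + 1) ≤ Q := by linarith
    linarith
  have hlog : 1 / 2 ≤ Real.sqrt (Real.log N) := by
    apply Real.le_sqrt_of_sq_le
    have h1 : Real.log 2 ≤ Real.log N :=
      Real.log_le_log (by norm_num) (by exact_mod_cast hN)
    have := Real.log_two_gt_d9
    norm_num
    linarith
  rw [le_div_iff₀ hrpos]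
  refine hIr.trans ?_
  have hP : 0 ≤ m * (K * (1 + m / c) + Lg + 1) * Q := by positivity
  have := mul_le_mul_of_nonneg_left hlog hP
  linarith
end
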